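/- arXiv:1404.5164 — 2 statements merged into one kernel-verified Lean document; each statement's English description precedes it below -/
import Mathlib

section
/- Let r : S¹ → ℝ² be a C^∞ immersion with nonempty no-silhouette 𝒩𝒮_r and aperture angle θ_r. Then for every θ ∈ [0, θ_r), there exists a parallel translation T_θ : ℝ² → ℝ² such that T_θ(closure(𝒩𝒮_{θ,r})) is the Wulff shape 𝒲_{h_θ} associated with some continuous support function h_θ : S¹ → ℝ₊. -/
open Real

/-- Rotation of the plane by angle `θ`. -/
noncomputable def rot (θ : ℝ) (v : ℝ × ℝ) : ℝ × ℝ :=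
  (v.1 * Real.cos θ - v.2 * Real.sin θ, v.1 * Real.sin θ + v.2 * Real.cos θ)

/-- The set `𝒩𝒮_{θ,r}`: the complement of the union over `s` of the tangent
lines of `r` rotated by the angle `θ` about their points of tangency.
The circle `S¹` is modelled by `2π`-periodic maps `r : ℝ → ℝ × ℝ`. -/
noncomputable def NS (θ : ℝ) (r : ℝ → ℝ × ℝ) : Set (ℝ × ℝ) :=
  (⋃ s : ℝ, {P : ℝ × ℝ | ∃ t : ℝ, P = r s + t • rot θ (deriv r s)})ᶜ

/-- The Wulff shape associated with a support function `h` on `S¹`, the circle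
being parametrised by angle: `𝒲_h = ⋂_{λ} {P | P ⬝ (cos λ, sin λ) ≤ h λ}`. -/
noncomputable def Wulff (h : ℝ → ℝ) : Set (ℝ × ℝ) :=
  ⋂ lam : ℝ, {P : ℝ × ℝ | P.1 * Real.cos lam + P.2 * Real.sin lam ≤ h lam}

/-- A compact convex set with `Q` in its interior is, after translating `Q` to the origin,
the Wulff shape of its support function. -/
theorem exists_wulff_of_isCompact_convex {K : Set (ℝ × ℝ)} (hK : IsCompact K)
    (hconv : Convex ℝ K) {Q : ℝ × ℝ} (hQ : Q ∈ interior K) :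
    ∃ (v : ℝ × ℝ) (h : ℝ → ℝ), Continuous h ∧ Function.Periodic h (2 * π) ∧
      (∀ lam : ℝ, 0 < h lam) ∧ (fun P : ℝ × ℝ => P + v) '' K = Wulff h := by
  let F : ℝ → ℝ × ℝ → ℝ := fun lam P =>
    (P.1 - Q.1) * Real.cos lam + (P.2 - Q.2) * Real.sin lam
  have hF : Continuous ↿F := by
    change Continuous fun p : ℝ × (ℝ × ℝ) =>
      (p.2.1 - Q.1) * Real.cos p.1 + (p.2.2 - Q.2) * Real.sin p.1
    fun_prop
  have hFlam : ∀ lam, Continuous (F lam) := fun lam => by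
    change Continuous fun P : ℝ × ℝ => (P.1 - Q.1) * Real.cos lam + (P.2 - Q.2) * Real.sin lam
    fun_prop
  have hle : ∀ lam, ∀ P ∈ K, F lam P ≤ sSup (F lam '' K) := fun lam P hP =>
    le_csSup (hK.image (hFlam lam)).bddAbove (Set.mem_image_of_mem _ hP)
  refine ⟨-Q, fun lam => sSup (F lam '' K), hK.continuous_sSup hF, ?_, ?_, ?_⟩
  · intro lam
    simp only [F, Real.cos_add_two_pi, Real.sin_add_two_pi]
  · intro lam
    have hcont : Continuous fun t : ℝ => Q + t • (Real.cos lam, Real.sin lam) := by fun_prop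
    have hev : ∀ᶠ t : ℝ in nhds 0, Q + t • (Real.cos lam, Real.sin lam) ∈ K := by
      apply hcont.continuousAt.eventually_mem
      simpa using mem_interior_iff_mem_nhds.1 hQ
    obtain ⟨t, ht, htpos⟩ :=
      ((hev.filter_mono nhdsWithin_le_nhds).and
        (self_mem_nhdsWithin : Set.Ioi (0 : ℝ) ∈ nhdsWithin 0 (Set.Ioi 0))).exists
    have htpos : 0 < t := htpos
    refine lt_of_lt_of_le htpos ((hle lam _ ht).trans' (le_of_eq ?_))
    simp only [F, Prod.fst_add, Prod.snd_add, Prod.smul_fst, Prod.smul_snd, smul_eq_mul]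
    linear_combination -t * Real.sin_sq_add_cos_sq lam
  · ext P
    simp only [Wulff, Set.mem_iInter, Set.mem_ofPred_eq, Set.mem_image]
    constructor
    · rintro ⟨P, hP, rfl⟩ lam
      simpa [F, sub_eq_add_neg] using hle lam P hP
    · intro hP
      refine ⟨P + Q, ?_, by simp⟩
      by_contra hPK
      obtain ⟨f, u, hfu, huf⟩ := geometric_hahn_banach_closed_point hconv hK.isClosed hPK
      have hf : ∀ X : ℝ × ℝ, f X = X.1 * f (1, 0) + X.2 * f (0, 1) := by
        intro X
        conv_lhs => rw [show X = X.1 • ((1, 0) : ℝ × ℝ) + X.2 • ((0, 1) : ℝ × ℝ) by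
          ext <;> simp]
        simp only [map_add, map_smul, smul_eq_mul]
      set z : ℂ := ⟨f (1, 0), f (0, 1)⟩
      have h1 : f (1, 0) = ‖z‖ * Real.cos z.arg := (Complex.norm_mul_cos_arg z).symm
      have h2 : f (0, 1) = ‖z‖ * Real.sin z.arg := (Complex.norm_mul_sin_arg z).symm
      obtain ⟨X, hX, hXmax⟩ := hK.exists_isMaxOn ⟨Q, interior_subset hQ⟩ (hFlam z.arg).continuousOn
      have hsup : sSup (F z.arg '' K) ≤ F z.arg X := by
        refine csSup_le ⟨_, Set.mem_image_of_mem _ hX⟩ ?_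
        rintro _ ⟨Y, hY, rfl⟩
        exact hXmax hY
      have h3 := mul_le_mul_of_nonneg_left ((hP z.arg).trans hsup) (norm_nonneg z)
      have h4 := (hfu X hX).trans huf
      rw [hf X, hf (P + Q), h1, h2] at h4
      simp only [F, Prod.fst_add, Prod.snd_add] at h3 h4
      linarith

section HalfPlanes

variable {a b c : ℝ → ℝ}

/-- The intersection of a periodic continuous family of open half-planes is open. -/
theorem isOpen_setOf_forall_halfPlane (ha : Continuous a) (hb : Continuous b)
    (hc : Continuous c) {T : ℝ} (hT : 0 < T) (hap : Function.Periodic a T)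
    (hbp : Function.Periodic b T) (hcp : Function.Periodic c T) :
    IsOpen {P : ℝ × ℝ | ∀ s, 0 < P.1 * a s + P.2 * b s + c s} := by
  have hset : {P : ℝ × ℝ | ∀ s, 0 < P.1 * a s + P.2 * b s + c s} =
      {P : ℝ × ℝ | ∀ s ∈ Set.Icc 0 T, 0 < P.1 * a s + P.2 * b s + c s} := by
    ext P
    refine ⟨fun h s _ => h s, fun h s => ?_⟩
    have hper : Function.Periodic (fun s => P.1 * a s + P.2 * b s + c s) T := fun s => by
      simp only [hap s, hbp s, hcp s]
    obtain ⟨y, hy, hys⟩ := hper.exists_mem_Ico₀ hT s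
    exact hys ▸ h y (Set.Ico_subset_Icc_self hy)
  rw [hset, isOpen_iff_mem_nhds]
  intro P hP
  refine isCompact_Icc.eventually_forall_of_forall_eventually fun s hs => ?_
  have hcont : Continuous fun p : (ℝ × ℝ) × ℝ => p.1.1 * a p.2 + p.1.2 * b p.2 + c p.2 := by
    fun_prop
  exact hcont.continuousAt.eventually (lt_mem_nhds (hP s hs))

/-- The closure of a nonempty intersection of open half-planes is the intersection of the
closed half-planes. -/
theorem closure_setOf_forall_halfPlane
    (hne : {P : ℝ × ℝ | ∀ s, 0 < P.1 * a s + P.2 * b s + c s}.Nonempty) :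
    closure {P : ℝ × ℝ | ∀ s, 0 < P.1 * a s + P.2 * b s + c s} =
      {P : ℝ × ℝ | ∀ s, 0 ≤ P.1 * a s + P.2 * b s + c s} := by
  apply Set.Subset.antisymm
  · refine closure_minimal (fun P hP s => (hP s).le) ?_
    simp only [Set.ofPred_forall]
    exact isClosed_iInter fun s => isClosed_le continuous_const (by fun_prop)
  · intro P hP
    obtain ⟨Q, hQ⟩ := hne
    have hcont : Continuous fun t : ℝ => P + t • (Q - P) := by fun_prop
    have htend : Filter.Tendsto (fun t : ℝ => P + t • (Q - P)) (nhdsWithin 0 (Set.Ioi 0))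
        (nhds P) := by
      have := hcont.tendsto 0
      simp only [zero_smul, add_zero] at this
      exact this.mono_left nhdsWithin_le_nhds
    refine mem_closure_of_tendsto htend ?_
    filter_upwards [Ioo_mem_nhdsGT (zero_lt_one' ℝ)] with t ht s
    simp only [Prod.fst_add, Prod.snd_add, Prod.smul_fst, Prod.smul_snd, smul_eq_mul,
      Prod.fst_sub, Prod.snd_sub]
    have h1 := mul_pos ht.1 (hQ s)
    have h2 := mul_nonneg (sub_nonneg.2 ht.2.le) (hP s)
    linarith

theorem convex_setOf_forall_halfPlane :
    Convex ℝ {P : ℝ × ℝ | ∀ s, 0 ≤ P.1 * a s + P.2 * b s + c s} := by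
  intro P hP Q hQ x y hx hy hxy s
  simp only [Prod.fst_add, Prod.snd_add, Prod.smul_fst, Prod.smul_snd, smul_eq_mul]
  have h1 := mul_nonneg hx (hP s)
  have h2 := mul_nonneg hy (hQ s)
  have h3 : (x + y) * c s = c s := by rw [hxy, one_mul]
  linarith

/-- An intersection of closed half-planes with trivial recession cone is bounded. -/
theorem isBounded_setOf_forall_halfPlane
    (hrec : ∀ w : ℝ × ℝ, (∀ s, 0 ≤ w.1 * a s + w.2 * b s) → w = 0) :
    Bornology.IsBounded {P : ℝ × ℝ | ∀ s, 0 ≤ P.1 * a s + P.2 * b s + c s} := by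
  by_contra hunb
  have hfar : ∀ k : ℕ, ∃ P ∈ {P : ℝ × ℝ | ∀ s, 0 ≤ P.1 * a s + P.2 * b s + c s},
      (k : ℝ) + 1 < ‖P‖ := by
    intro k
    by_contra! h
    exact hunb (isBounded_iff_forall_norm_le.2 ⟨_, h⟩)
  choose P hP hPk using hfar
  have hpos : ∀ k, 0 < ‖P k‖ := fun k => lt_trans (by positivity) (hPk k)
  have hsphere : ∀ k, ‖P k‖⁻¹ • P k ∈ Metric.sphere (0 : ℝ × ℝ) 1 := fun k => by
    simp [norm_smul, (hpos k).ne']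
  obtain ⟨w, hw, φ, hφ, hlim⟩ := (isCompact_sphere (0 : ℝ × ℝ) 1).tendsto_subseq hsphere
  have hinv : Filter.Tendsto (fun k => ‖P (φ k)‖⁻¹) Filter.atTop (nhds 0) := by
    have hnorm : Filter.Tendsto (fun k => ‖P k‖) Filter.atTop Filter.atTop :=
      Filter.tendsto_atTop_mono (fun k => by linarith [hPk k]) tendsto_natCast_atTop_atTop
    exact tendsto_inv_atTop_zero.comp (hnorm.comp hφ.tendsto_atTop)
  have hw0 : w = 0 := by
    refine hrec w fun s => ?_
    have hcont : Continuous fun X : ℝ × ℝ => X.1 * a s + X.2 * b s := by fun_prop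
    have hlim' := ((hcont.tendsto w).comp hlim).add (hinv.mul_const (c s))
    rw [zero_mul, add_zero] at hlim'
    refine ge_of_tendsto' hlim' fun k => ?_
    have h := mul_nonneg (inv_nonneg.2 (norm_nonneg (P (φ k)))) (hP (φ k) s)
    simp only [Function.comp_apply, Prod.smul_fst, Prod.smul_snd, smul_eq_mul]
    linarith
  simp [hw0] at hw

/-- The closure of a nonempty intersection of a periodic continuous family of open half-planes
with trivial recession cone is a translate of a Wulff shape. -/
theorem exists_wulff_closure_halfPlane (ha : Continuous a) (hb : Continuous b)
    (hc : Continuous c) {T : ℝ} (hT : 0 < T) (hap : Function.Periodic a T)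
    (hbp : Function.Periodic b T) (hcp : Function.Periodic c T)
    (hrec : ∀ w : ℝ × ℝ, (∀ s, 0 ≤ w.1 * a s + w.2 * b s) → w = 0)
    (hne : {P : ℝ × ℝ | ∀ s, 0 < P.1 * a s + P.2 * b s + c s}.Nonempty) :
    ∃ (v : ℝ × ℝ) (h : ℝ → ℝ), Continuous h ∧ Function.Periodic h (2 * π) ∧
      (∀ lam : ℝ, 0 < h lam) ∧
      (fun P : ℝ × ℝ => P + v) '' closure {P : ℝ × ℝ | ∀ s, 0 < P.1 * a s + P.2 * b s + c s} =
        Wulff h := by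
  have hopen := isOpen_setOf_forall_halfPlane ha hb hc hT hap hbp hcp
  have hclos := closure_setOf_forall_halfPlane hne
  have hcompact : IsCompact
      (closure {P : ℝ × ℝ | ∀ s, 0 < P.1 * a s + P.2 * b s + c s}) := by
    refine Metric.isCompact_of_isClosed_isBounded isClosed_closure ?_
    rw [hclos]
    exact isBounded_setOf_forall_halfPlane hrec
  obtain ⟨Q, hQ⟩ := hne
  refine exists_wulff_of_isCompact_convex hcompact ?_ (interior_maximal subset_closure hopen hQ)
  rw [hclos]
  exact convex_setOf_forall_halfPlane

end HalfPlanes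

section PeriodicCurve

variable {r : ℝ → ℝ × ℝ}

theorem hasDerivAt_linear_comp (hr : Differentiable ℝ r) (p q s : ℝ) :
    HasDerivAt (fun s => p * (r s).1 + q * (r s).2)
      (p * (deriv r s).1 + q * (deriv r s).2) s := by
  have h1 : HasDerivAt (fun s => (r s).1) (deriv r s).1 s := by
    simpa using (hr s).hasDerivAt.hasFDerivAt.fst.hasDerivAt
  have h2 : HasDerivAt (fun s => (r s).2) (deriv r s).2 s := by
    simpa using (hr s).hasDerivAt.hasFDerivAt.snd.hasDerivAt
  exact (h1.const_mul p).add (h2.const_mul q)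

theorem exists_linear_deriv_eq_zero (hr : Differentiable ℝ r) {T : ℝ} (hT : 0 < T)
    (hper : Function.Periodic r T) (p q : ℝ) :
    ∃ s, p * (deriv r s).1 + q * (deriv r s).2 = 0 := by
  obtain ⟨s, -, hs⟩ := exists_hasDerivAt_eq_zero hT
    (fun s _ => (hasDerivAt_linear_comp hr p q s).continuousAt.continuousWithinAt)
    (by simp [hper.eq]) (fun s _ => hasDerivAt_linear_comp hr p q s)
  exact ⟨s, hs⟩

theorem linear_deriv_eq_zero_of_nonneg (hr : Differentiable ℝ r) {T : ℝ} (hT : 0 < T)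
    (hper : Function.Periodic r T) {p q : ℝ}
    (h : ∀ s, 0 ≤ p * (deriv r s).1 + q * (deriv r s).2) (s : ℝ) :
    p * (deriv r s).1 + q * (deriv r s).2 = 0 := by
  set g : ℝ → ℝ := fun s => p * (r s).1 + q * (r s).2 with hg
  have hd : ∀ s, HasDerivAt g _ s := hasDerivAt_linear_comp hr p q
  have hmono : Monotone g := monotone_of_hasDerivAt_nonneg hd h
  have hgper : Function.Periodic g T := fun s => by simp only [hg, hper s]
  have hconst : ∀ x, g x = g 0 := by
    intro x
    obtain ⟨y, hy, hxy⟩ := hgper.exists_mem_Ico₀ hT x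
    rw [hxy]
    exact le_antisymm ((hmono hy.2.le).trans_eq hgper.eq) (hmono hy.1)
  rw [← (hd s).deriv, show g = fun _ => g 0 from funext hconst, deriv_const]

theorem eq_zero_of_linear_deriv_nonneg (hr : Differentiable ℝ r) {T : ℝ} (hT : 0 < T)
    (hper : Function.Periodic r T) (himm : ∀ s, deriv r s ≠ 0) {p q : ℝ}
    (h : ∀ s, 0 ≤ p * (deriv r s).1 + q * (deriv r s).2) : p ^ 2 + q ^ 2 = 0 := by
  obtain ⟨s, hs⟩ := exists_linear_deriv_eq_zero hr hT hper (-q) p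
  have hs' := linear_deriv_eq_zero_of_nonneg hr hT hper h s
  by_contra hpq
  refine himm s (Prod.ext ?_ ?_)
  · refine (mul_eq_zero.1 ?_).resolve_left hpq
    linear_combination p * hs' - q * hs
  · refine (mul_eq_zero.1 ?_).resolve_left hpq
    linear_combination q * hs' + p * hs

end PeriodicCurve

/-- A point `P` lies on the line through `X` with direction `v ≠ 0` iff the cross product of
`P - X` with `v` vanishes. -/
theorem exists_eq_add_smul_iff {P X v : ℝ × ℝ} (hv : v ≠ 0) :
    (∃ t : ℝ, P = X + t • v) ↔ (P.1 - X.1) * v.2 - (P.2 - X.2) * v.1 = 0 := by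
  constructor
  · rintro ⟨t, rfl⟩
    simp only [Prod.fst_add, Prod.snd_add, Prod.smul_fst, Prod.smul_snd, smul_eq_mul]
    ring
  · intro h
    have hn : v.1 ^ 2 + v.2 ^ 2 ≠ 0 := by
      intro h0
      refine hv (Prod.ext ?_ ?_) <;> simp only [Prod.fst_zero, Prod.snd_zero] <;>
        nlinarith [sq_nonneg v.1, sq_nonneg v.2]
    refine ⟨((P.1 - X.1) * v.1 + (P.2 - X.2) * v.2) / (v.1 ^ 2 + v.2 ^ 2), Prod.ext ?_ ?_⟩
    · simp only [Prod.fst_add, Prod.smul_fst, smul_eq_mul]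
      field_simp
      linear_combination v.2 * h
    · simp only [Prod.snd_add, Prod.smul_snd, smul_eq_mul]
      field_simp
      linear_combination -v.1 * h

theorem rot_ne_zero (θ : ℝ) {v : ℝ × ℝ} (hv : v ≠ 0) : rot θ v ≠ 0 := by
  intro h
  have h1 : v.1 * Real.cos θ - v.2 * Real.sin θ = 0 := congrArg Prod.fst h
  have h2 : v.1 * Real.sin θ + v.2 * Real.cos θ = 0 := congrArg Prod.snd h
  refine hv (Prod.ext ?_ ?_) <;> simp only [Prod.fst_zero, Prod.snd_zero]
  · linear_combination Real.cos θ * h1 + Real.sin θ * h2 - v.1 * Real.sin_sq_add_cos_sq θ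
  · linear_combination Real.cos θ * h2 - Real.sin θ * h1 - v.2 * Real.sin_sq_add_cos_sq θ

theorem mem_NS_iff {θ : ℝ} {r : ℝ → ℝ × ℝ} (himm : ∀ s, deriv r s ≠ 0) {P : ℝ × ℝ} :
    P ∈ NS θ r ↔ ∀ s, (P.1 - (r s).1) * (rot θ (deriv r s)).2 -
      (P.2 - (r s).2) * (rot θ (deriv r s)).1 ≠ 0 := by
  simp only [NS, Set.mem_compl_iff, Set.mem_iUnion, Set.mem_ofPred_eq, not_exists, ne_eq,
    ← exists_eq_add_smul_iff (rot_ne_zero θ (himm _))]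

theorem forall_pos_or_forall_neg {f : ℝ → ℝ} (hf : Continuous f) (h0 : ∀ s, f s ≠ 0) :
    (∀ s, 0 < f s) ∨ ∀ s, f s < 0 := by
  by_contra! h
  obtain ⟨⟨x, hx⟩, y, hy⟩ := h
  obtain ⟨s, hs⟩ := mem_range_of_exists_le_of_exists_ge hf ⟨x, hx⟩ ⟨y, hy⟩
  exact h0 s hs

/-- The points of `NS θ r` lie on one common side of all the rotated tangent lines. -/
theorem exists_sign_NS_eq {θ : ℝ} {r : ℝ → ℝ × ℝ} (hr : ContDiff ℝ 1 r) {T : ℝ} (hT : 0 < T)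
    (hper : Function.Periodic r T) (himm : ∀ s, deriv r s ≠ 0) (hne : (NS θ r).Nonempty) :
    ∃ ε : ℝ, ε ≠ 0 ∧ NS θ r = {P : ℝ × ℝ | ∀ s,
      0 < ε * ((P.1 - (r s).1) * (rot θ (deriv r s)).2 -
        (P.2 - (r s).2) * (rot θ (deriv r s)).1)} := by
  have hdiff : Differentiable ℝ r := hr.differentiable one_ne_zero
  have hcr : Continuous r := hr.continuous
  have hcd : Continuous (deriv r) := hr.continuous_deriv le_rfl
  have hcont : ∀ P : ℝ × ℝ, Continuous fun s => (P.1 - (r s).1) * (rot θ (deriv r s)).2 -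
      (P.2 - (r s).2) * (rot θ (deriv r s)).1 := fun P => by
    simp only [rot]
    fun_prop
  have hsep : ∀ P Q : ℝ × ℝ,
      (∀ s, 0 < (P.1 - (r s).1) * (rot θ (deriv r s)).2 -
        (P.2 - (r s).2) * (rot θ (deriv r s)).1) →
      ¬ ∀ s, (Q.1 - (r s).1) * (rot θ (deriv r s)).2 -
        (Q.2 - (r s).2) * (rot θ (deriv r s)).1 < 0 := by
    intro P Q hP hQ
    obtain ⟨s, hs⟩ := exists_linear_deriv_eq_zero hdiff hT hper
      ((P.1 - Q.1) * Real.sin θ - (P.2 - Q.2) * Real.cos θ)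
      ((P.1 - Q.1) * Real.cos θ + (P.2 - Q.2) * Real.sin θ)
    have h1 := hP s
    have h2 := hQ s
    simp only [rot] at h1 h2
    linarith
  obtain ⟨Q, hQ⟩ := hne
  rcases forall_pos_or_forall_neg (hcont Q) ((mem_NS_iff himm).1 hQ) with hQ' | hQ'
  · refine ⟨1, one_ne_zero, Set.ext fun P => ?_⟩
    rw [mem_NS_iff himm]
    simp only [one_mul, Set.mem_ofPred_eq]
    exact ⟨fun hP => (forall_pos_or_forall_neg (hcont P) hP).resolve_right (hsep Q P hQ'),
      fun hP s => (hP s).ne'⟩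
  · refine ⟨-1, by norm_num, Set.ext fun P => ?_⟩
    rw [mem_NS_iff himm]
    simp only [neg_one_mul, Left.neg_pos_iff, Set.mem_ofPred_eq]
    exact ⟨fun hP => (forall_pos_or_forall_neg (hcont P) hP).resolve_left
      fun hP' => hsep P Q hP' hQ', fun hP s => (hP s).ne⟩

/-- Let `r` be a `C^∞` immersion of `S¹` in the plane with nonempty
no-silhouette and aperture angle `θr`.  Then for every `θ ∈ [0, θr)` there is
a parallel translation `T_θ` carrying the closure of `𝒩𝒮_{θ,r}` onto the
Wulff shape of some continuous positive support function `h_θ : S¹ → ℝ₊`. -/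
theorem closure_NS_isWulff (r : ℝ → ℝ × ℝ)
    (hsmooth : ContDiff ℝ (⊤ : ℕ∞) r) (hper : Function.Periodic r (2 * π))
    (himm : ∀ s : ℝ, deriv r s ≠ 0)
    (hNS : (NS 0 r).Nonempty)
    (θr : ℝ) (hθr0 : 0 < θr) (hθr1 : θr ≤ π / 2)
    (haperture : ∀ θ : ℝ, 0 ≤ θ → θ < θr → (NS θ r).Nonempty)
    (hlargest : ∀ a : ℝ, (∀ θ : ℝ, 0 ≤ θ → θ < a → (NS θ r).Nonempty) → a ≤ θr)
    (θ : ℝ) (hθ0 : 0 ≤ θ) (hθ1 : θ < θr) :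
    ∃ (v : ℝ × ℝ) (h : ℝ → ℝ), Continuous h ∧ Function.Periodic h (2 * π) ∧
      (∀ lam : ℝ, 0 < h lam) ∧
      (fun P : ℝ × ℝ => P + v) '' closure (NS θ r) = Wulff h := by
  have hT : 0 < 2 * π := Real.two_pi_pos
  have hr : ContDiff ℝ 1 r := hsmooth.of_le (by exact_mod_cast le_top)
  have hdiff : Differentiable ℝ r := hr.differentiable one_ne_zero
  have hcr : Continuous r := hr.continuous
  have hcd : Continuous (deriv r) := hr.continuous_deriv le_rfl
  have hdper : Function.Periodic (deriv r) (2 * π) := fun s => by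
    rw [← deriv_comp_add_const, show (fun x => r (x + 2 * π)) = r from funext hper]
  have hne := haperture θ hθ0 hθ1
  obtain ⟨ε, hε, hset⟩ := exists_sign_NS_eq hr hT hper himm hne
  have hset' : NS θ r = {P : ℝ × ℝ | ∀ s, 0 < P.1 * (ε * (rot θ (deriv r s)).2) +
      P.2 * (-ε * (rot θ (deriv r s)).1) +
      ε * ((r s).2 * (rot θ (deriv r s)).1 - (r s).1 * (rot θ (deriv r s)).2)} := by
    rw [hset]
    ext P
    refine forall_congr' fun s => ?_
    ring_nf
  rw [hset'] at hne ⊢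
  refine exists_wulff_closure_halfPlane (by simp only [rot]; fun_prop)
    (by simp only [rot]; fun_prop) (by simp only [rot]; fun_prop) hT
    (fun s => by simp only [hdper s]) (fun s => by simp only [hdper s])
    (fun s => by simp only [hdper s, hper s]) (fun w hw => ?_) hne
  have h0 := eq_zero_of_linear_deriv_nonneg hdiff hT hper himm
    (p := ε * (w.1 * Real.sin θ - w.2 * Real.cos θ))
    (q := ε * (w.1 * Real.cos θ + w.2 * Real.sin θ)) fun s => by
      have h := hw s
      simp only [rot] at h
      linarith
  have h1 : ε ^ 2 * (w.1 ^ 2 + w.2 ^ 2) = 0 := by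
    linear_combination h0 - ε ^ 2 * (w.1 ^ 2 + w.2 ^ 2) * Real.sin_sq_add_cos_sq θ
  have h2 := (mul_eq_zero.1 h1).resolve_left (pow_ne_zero 2 hε)
  refine Prod.ext ?_ ?_ <;> simp only [Prod.fst_zero, Prod.snd_zero] <;>
    nlinarith [sq_nonneg w.1, sq_nonneg w.2]
end

section
/- Let r : S¹ → ℝ² be a C^∞ immersion with nonempty no-silhouette 𝒩𝒮_r and aperture angle θ_r. Then the map ω : [0, θ_r) → 𝓗(ℝ²) defined by ω(θ) = closure(𝒩𝒮_{θ,r}) is continuous with respect to the Pompeiu–Hausdorff metric. -/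
open Real Filter

/-- The determinant of the rotated tangent vector `rot θ (deriv r s)` and `P - r s`; its sign tells
on which side of the rotated tangent line the point `P` lies. -/
noncomputable def tangentSide (r : ℝ → ℝ × ℝ) (θ : ℝ) (P : ℝ × ℝ) (s : ℝ) : ℝ :=
  Real.cos θ * ((deriv r s).1 * (P.2 - (r s).2) - (deriv r s).2 * (P.1 - (r s).1)) -
    Real.sin θ * ((deriv r s).1 * (P.1 - (r s).1) + (deriv r s).2 * (P.2 - (r s).2))

theorem mem_NS_iff_tangentSide_ne_zero {r : ℝ → ℝ × ℝ} (himm : ∀ s, deriv r s ≠ 0)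
    (θ : ℝ) (P : ℝ × ℝ) : P ∈ NS θ r ↔ ∀ s, tangentSide r θ P s ≠ 0 := by
  simp only [NS, Set.mem_compl_iff, Set.mem_iUnion, Set.mem_ofPred_eq, not_exists]
  refine forall_congr' fun s => ?_
  rw [← not_exists, not_iff_not]
  have hcs := Real.sin_sq_add_cos_sq θ
  constructor
  · rintro ⟨t, rfl⟩
    simp only [tangentSide, rot, Prod.fst_add, Prod.snd_add, Prod.smul_fst, Prod.smul_snd,
      smul_eq_mul]
    ring
  · intro h
    have hn : (deriv r s).1 ^ 2 + (deriv r s).2 ^ 2 ≠ 0 := by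
      intro h0
      apply himm s
      ext
      · simp only [Prod.fst_zero]
        nlinarith [sq_nonneg (deriv r s).1, sq_nonneg (deriv r s).2]
      · simp only [Prod.snd_zero]
        nlinarith [sq_nonneg (deriv r s).1, sq_nonneg (deriv r s).2]
    unfold tangentSide at h
    simp only [rot]
    set a := (deriv r s).1
    set b := (deriv r s).2
    set u := P.1 - (r s).1 with hu
    set v := P.2 - (r s).2 with hv
    set c := Real.cos θ
    set d := Real.sin θ
    refine ⟨((a * c - b * d) * u + (a * d + b * c) * v) / (a ^ 2 + b ^ 2), ?_⟩
    ext
    · simp only [Prod.fst_add, Prod.smul_fst, smul_eq_mul]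
      rw [← sub_eq_iff_eq_add', ← hu]
      field_simp
      linear_combination (-(a ^ 2 + b ^ 2) * u) * hcs - (a * d + b * c) * h
    · simp only [Prod.snd_add, Prod.smul_snd, smul_eq_mul]
      rw [← sub_eq_iff_eq_add', ← hv]
      field_simp
      linear_combination (-(a ^ 2 + b ^ 2) * v) * hcs + (a * c - b * d) * h

theorem continuous_tangentSide {r : ℝ → ℝ × ℝ} (hr : Continuous r) (hr' : Continuous (deriv r))
    (θ : ℝ) (P : ℝ × ℝ) : Continuous (tangentSide r θ P) := by
  unfold tangentSide
  fun_prop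

theorem Function.Periodic.deriv_of_periodic {r : ℝ → ℝ × ℝ} {c : ℝ}
    (h : Function.Periodic r c) : Function.Periodic (deriv r) c := by
  intro s
  rw [← deriv_comp_add_const]
  congr 1
  exact funext h

theorem Function.Periodic.tangentSide {r : ℝ → ℝ × ℝ} {c : ℝ} (h : Function.Periodic r c)
    (θ : ℝ) (P : ℝ × ℝ) : Function.Periodic (tangentSide r θ P) c := by
  intro s
  simp only [_root_.tangentSide, h s, h.deriv_of_periodic s]

theorem tangentSide_convexComb (r : ℝ → ℝ × ℝ) (θ : ℝ) (P Q : ℝ × ℝ) (t s : ℝ) :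
    tangentSide r θ (P + t • (Q - P)) s =
      (1 - t) * tangentSide r θ P s + t * tangentSide r θ Q s := by
  simp only [tangentSide, Prod.fst_add, Prod.snd_add, Prod.smul_fst, Prod.smul_snd, smul_eq_mul,
    Prod.fst_sub, Prod.snd_sub]
  ring

/-- A differentiable periodic function has a critical point. -/
theorem Function.Periodic.exists_hasDerivAt_eq_zero {f f' : ℝ → ℝ} {c : ℝ} (hc : 0 < c)
    (h : Function.Periodic f c) (hf : ∀ s, HasDerivAt f (f' s) s) : ∃ s, f' s = 0 := by
  obtain ⟨s, -, hs⟩ := _root_.exists_hasDerivAt_eq_zero hc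
    (fun s _ => (hf s).continuousAt.continuousWithinAt) (by simpa using (h 0).symm)
    (fun s _ => hf s)
  exact ⟨s, hs⟩

theorem hasDerivAt_fst_of_differentiable {r : ℝ → ℝ × ℝ} (hd : Differentiable ℝ r) (s : ℝ) :
    HasDerivAt (fun s => (r s).1) (deriv r s).1 s :=
  (hasFDerivAt_fst (𝕜 := ℝ) (p := r s)).comp_hasDerivAt s (hd s).hasDerivAt

theorem hasDerivAt_snd_of_differentiable {r : ℝ → ℝ × ℝ} (hd : Differentiable ℝ r) (s : ℝ) :
    HasDerivAt (fun s => (r s).2) (deriv r s).2 s :=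
  (hasFDerivAt_snd (𝕜 := ℝ) (p := r s)).comp_hasDerivAt s (hd s).hasDerivAt

/-- After division by `cos θ`, the side functions of any two points and angles differ by the
derivative of a periodic function, so they cannot be separated by sign. -/
theorem not_tangentSide_pos_and_neg {r : ℝ → ℝ × ℝ} {c : ℝ} (hc : 0 < c)
    (hd : Differentiable ℝ r) (hper : Function.Periodic r c) {θ φ : ℝ} (hθ : 0 < Real.cos θ)
    (hφ : 0 < Real.cos φ) {P Q : ℝ × ℝ} (hP : ∀ s, 0 < tangentSide r θ P s)
    (hQ : ∀ s, tangentSide r φ Q s < 0) : False := by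
  have hx := hasDerivAt_fst_of_differentiable hd
  have hy := hasDerivAt_snd_of_differentiable hd
  let Φ : ℝ → ℝ := fun s =>
    Real.cos θ * Real.cos φ * ((r s).1 * (P.2 - Q.2) - (r s).2 * (P.1 - Q.1))
      - Real.cos φ * Real.sin θ *
        ((r s).1 * P.1 + (r s).2 * P.2 - ((r s).1 * (r s).1 + (r s).2 * (r s).2) / 2)
      + Real.cos θ * Real.sin φ *
        ((r s).1 * Q.1 + (r s).2 * Q.2 - ((r s).1 * (r s).1 + (r s).2 * (r s).2) / 2)
  have hΦper : Function.Periodic Φ c := fun s => by simp only [Φ, hper s]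
  have hΦ : ∀ s, HasDerivAt Φ
      (Real.cos φ * tangentSide r θ P s - Real.cos θ * tangentSide r φ Q s) s := by
    intro s
    have hsq := (((hx s).mul (hx s)).add ((hy s).mul (hy s))).div_const 2
    have h1 := (((hx s).mul_const (P.2 - Q.2)).sub ((hy s).mul_const (P.1 - Q.1))).const_mul
      (Real.cos θ * Real.cos φ)
    have h2 := ((((hx s).mul_const P.1).add ((hy s).mul_const P.2)).sub hsq).const_mul
      (Real.cos φ * Real.sin θ)
    have h3 := ((((hx s).mul_const Q.1).add ((hy s).mul_const Q.2)).sub hsq).const_mul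
      (Real.cos θ * Real.sin φ)
    refine ((h1.sub h2).add h3).congr_deriv ?_
    simp only [tangentSide]
    ring
  obtain ⟨s, hs⟩ := hΦper.exists_hasDerivAt_eq_zero hc hΦ
  nlinarith [mul_pos hφ (hP s), mul_neg_of_pos_of_neg hθ (hQ s)]

/-- The chords of a closed immersed plane curve are not all parallel. -/
theorem exists_chords_det_ne_zero {r : ℝ → ℝ × ℝ} {c : ℝ} (hc : 0 < c)
    (hd : Differentiable ℝ r) (hper : Function.Periodic r c) (himm : ∀ s, deriv r s ≠ 0) :
    ∃ a b, (r a - r 0).1 * (r b - r 0).2 - (r a - r 0).2 * (r b - r 0).1 ≠ 0 := by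
  by_contra! hcol
  have hx := hasDerivAt_fst_of_differentiable hd
  have hy := hasDerivAt_snd_of_differentiable hd
  obtain ⟨a, ha⟩ : ∃ a, r a ≠ r 0 := by
    by_contra! hconst
    apply himm 0
    rw [show r = fun _ => r 0 from funext hconst]
    simp
  set p := (r a - r 0).1 with hp
  set q := (r a - r 0).2 with hq
  have hpq : p ≠ 0 ∨ q ≠ 0 := by
    by_contra! h
    exact ha (sub_eq_zero.1 (Prod.ext h.1 h.2))
  have hpar : ∀ s, p * (deriv r s).2 - q * (deriv r s).1 = 0 := by
    intro s
    have h := ((hy s).const_mul p).sub ((hx s).const_mul q)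
    refine h.unique ?_
    convert hasDerivAt_const s (p * (r 0).2 - q * (r 0).1) using 1
    funext b
    have := hcol a b
    simp only [Prod.fst_sub, Prod.snd_sub] at this hp hq
    simp only [Pi.sub_apply]
    rw [← hp, ← hq] at this
    linarith
  have hlin : Function.Periodic (fun s => p * (r s).1 + q * (r s).2) c := fun s => by
    simp only [hper s]
  obtain ⟨s, hs⟩ := hlin.exists_hasDerivAt_eq_zero hc
    (fun s => ((hx s).const_mul p).add ((hy s).const_mul q))
  have hpos : p ^ 2 + q ^ 2 ≠ 0 := by
    rcases hpq with h | h <;> positivity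
  have h := hpar s
  apply himm s
  ext
  · refine (mul_eq_zero.1 (?_ : (p ^ 2 + q ^ 2) * (deriv r s).1 = 0)).resolve_left hpos
    linear_combination p * hs - q * h
  · refine (mul_eq_zero.1 (?_ : (p ^ 2 + q ^ 2) * (deriv r s).2 = 0)).resolve_left hpos
    linear_combination q * hs + p * h

theorem Function.Periodic.exists_norm_le {f : ℝ → ℝ × ℝ} {c : ℝ} (hc : 0 < c)
    (h : Function.Periodic f c) (hf : Continuous f) : ∃ L, 0 ≤ L ∧ ∀ s, ‖f s‖ ≤ L := by
  obtain ⟨L, hL⟩ := (h.compact_of_continuous hc.ne' hf).isBounded.exists_norm_le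
  exact ⟨L, (norm_nonneg _).trans (hL _ ⟨0, rfl⟩), fun s => hL _ ⟨s, rfl⟩⟩

theorem Function.Periodic.exists_pos_le {f : ℝ → ℝ} {c : ℝ} (hc : 0 < c)
    (h : Function.Periodic f c) (hf : Continuous f) (hpos : ∀ s, 0 < f s) :
    ∃ δ, 0 < δ ∧ ∀ s, δ ≤ f s := by
  obtain ⟨-, ⟨s₀, rfl⟩, hmin⟩ :=
    (h.compact_of_continuous hc.ne' hf).exists_isLeast (Set.range_nonempty f)
  exact ⟨f s₀, hpos s₀, fun s => hmin ⟨s, rfl⟩⟩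

/-- A periodic function whose derivative is at least `-M` oscillates by at most `M * c`. -/
theorem Function.Periodic.abs_sub_le_of_neg_le_deriv {f f' : ℝ → ℝ} {c M : ℝ} (hc : 0 < c)
    (hM : 0 ≤ M) (h : Function.Periodic f c) (hf : ∀ s, HasDerivAt f (f' s) s)
    (hf' : ∀ s, -M ≤ f' s) (a : ℝ) : |f a - f 0| ≤ M * c := by
  have hmono : Monotone fun s => f s + M * s := by
    have hder : ∀ s, HasDerivAt (fun s => f s + M * s) (f' s + M * 1) s := fun s =>
      (hf s).add ((hasDerivAt_id s).const_mul M)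
    refine monotone_of_deriv_nonneg (fun s => (hder s).differentiableAt) fun s => ?_
    rw [(hder s).deriv]
    linarith [hf' s]
  obtain ⟨b, hb, hab⟩ := h.exists_mem_Ico₀ hc a
  rw [hab]
  have h0 := hmono hb.1
  have h1 := hmono hb.2.le
  have h2 : f c = f 0 := by simpa using h 0
  simp only [h2] at h0 h1
  have h3 := mul_nonneg hM hb.1
  have h4 := mul_le_mul_of_nonneg_left hb.2.le hM
  rw [abs_le]
  constructor <;> linarith

/-- If `‖w‖ ≤ L` and `‖v‖ ≤ K`, the determinant and the dot product of `w` and `v` are at most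
`2 * L * K` in absolute value. -/
theorem abs_det_le_and_abs_dot_le {w v : ℝ × ℝ} {L K : ℝ} (hw : ‖w‖ ≤ L) (hv : ‖v‖ ≤ K) :
    |w.1 * v.2 - w.2 * v.1| ≤ 2 * L * K ∧ |w.1 * v.1 + w.2 * v.2| ≤ 2 * L * K := by
  have hL := (norm_nonneg _).trans hw
  have w1 : |w.1| ≤ L := (norm_fst_le w).trans hw
  have w2 : |w.2| ≤ L := (norm_snd_le w).trans hw
  have v1 : |v.1| ≤ K := (norm_fst_le v).trans hv
  have v2 : |v.2| ≤ K := (norm_snd_le v).trans hv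
  have key : ∀ {a b : ℝ}, |a| ≤ L → |b| ≤ K → |a * b| ≤ L * K := fun ha hb => by
    rw [abs_mul]
    exact mul_le_mul ha hb (abs_nonneg _) hL
  constructor
  · linarith [abs_sub (w.1 * v.2) (w.2 * v.1), key w1 v2, key w2 v1]
  · linarith [abs_add_le (w.1 * v.1) (w.2 * v.2), key w1 v1, key w2 v2]

/-- The points lying on one side of all rotated tangent lines are bounded uniformly in the angle. -/
theorem exists_norm_le_of_tangentSide_pos {r : ℝ → ℝ × ℝ} {c : ℝ} (hc : 0 < c)
    (hd : Differentiable ℝ r) (hr' : Continuous (deriv r)) (hper : Function.Periodic r c)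
    (himm : ∀ s, deriv r s ≠ 0) :
    ∃ D, ∀ (σ θ : ℝ) (P : ℝ × ℝ), |σ| = 1 → (∀ s, 0 < σ * tangentSide r θ P s) → ‖P‖ ≤ D := by
  have hx := hasDerivAt_fst_of_differentiable hd
  have hy := hasDerivAt_snd_of_differentiable hd
  obtain ⟨L, hL0, hL⟩ := hper.exists_norm_le hc hd.continuous
  obtain ⟨L', hL'0, hL'⟩ := hper.deriv_of_periodic.exists_norm_le hc hr'
  obtain ⟨a, b, hab⟩ := exists_chords_det_ne_zero hc hd hper himm
  set Δ := (r a - r 0).1 * (r b - r 0).2 - (r a - r 0).2 * (r b - r 0).1 with hΔ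
  set M := 4 * L' * L with hM
  have hM0 : 0 ≤ M := by positivity
  refine ⟨2 * (4 * L * (M * c) / |Δ|), fun σ θ P hσ hP => ?_⟩
  set u := Real.cos θ * P.1 + Real.sin θ * P.2 with hu
  set v := Real.cos θ * P.2 - Real.sin θ * P.1 with hv
  have hosc : ∀ s, |(r s - r 0).1 * v - (r s - r 0).2 * u| ≤ M * c := by
    have hGper : Function.Periodic (fun s => σ * ((r s).1 * v - (r s).2 * u)) c := fun s => by
      simp only [hper s]
    have hGder : ∀ s, -M ≤ σ * ((deriv r s).1 * v - (deriv r s).2 * u) := by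
      intro s
      have hdecomp : σ * ((deriv r s).1 * v - (deriv r s).2 * u) =
          σ * tangentSide r θ P s + σ * (Real.cos θ *
            ((deriv r s).1 * (r s).2 - (deriv r s).2 * (r s).1) -
            Real.sin θ * ((deriv r s).1 * (r s).1 + (deriv r s).2 * (r s).2)) := by
        simp only [tangentSide, hu, hv]
        ring
      obtain ⟨h1, h2⟩ := abs_det_le_and_abs_dot_le (hL' s) (hL s)
      set A := (deriv r s).1 * (r s).2 - (deriv r s).2 * (r s).1
      set B := (deriv r s).1 * (r s).1 + (deriv r s).2 * (r s).2
      have hbound : |σ * (Real.cos θ * A - Real.sin θ * B)| ≤ M := by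
        rw [abs_mul, hσ, one_mul]
        have hA : |Real.cos θ * A| ≤ 1 * (2 * L' * L) := by
          rw [abs_mul]
          exact mul_le_mul (Real.abs_cos_le_one θ) h1 (abs_nonneg _) zero_le_one
        have hB : |Real.sin θ * B| ≤ 1 * (2 * L' * L) := by
          rw [abs_mul]
          exact mul_le_mul (Real.abs_sin_le_one θ) h2 (abs_nonneg _) zero_le_one
        linarith [abs_sub (Real.cos θ * A) (Real.sin θ * B)]
      linarith [neg_abs_le (σ * (Real.cos θ * A - Real.sin θ * B)), hP s]
    intro s
    have h := hGper.abs_sub_le_of_neg_le_deriv hc hM0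
      (fun s => (((hx s).mul_const v).sub ((hy s).mul_const u)).const_mul σ) hGder s
    rw [← mul_sub, abs_mul, hσ, one_mul] at h
    refine (congrArg abs ?_).trans_le h
    simp only [Prod.fst_sub, Prod.snd_sub]
    ring
  have hchord : ∀ s, ‖r s - r 0‖ ≤ 2 * L := fun s => by
    linarith [norm_sub_le (r s) (r 0), hL s, hL 0]
  have hΔpos : 0 < |Δ| := abs_pos.2 hab
  have key : ∀ {p q g h : ℝ}, |p| ≤ 2 * L → |q| ≤ 2 * L → |g| ≤ M * c → |h| ≤ M * c →
      |p * g - q * h| ≤ 4 * L * (M * c) := by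
    intro p q g h hp hq hg hh
    have h1 : |p * g| ≤ 2 * L * (M * c) := by
      rw [abs_mul]
      exact mul_le_mul hp hg (abs_nonneg _) (by positivity)
    have h2 : |q * h| ≤ 2 * L * (M * c) := by
      rw [abs_mul]
      exact mul_le_mul hq hh (abs_nonneg _) (by positivity)
    linarith [abs_sub (p * g) (q * h)]
  have hvb : |v| ≤ 4 * L * (M * c) / |Δ| := by
    rw [le_div_iff₀ hΔpos, ← abs_mul]
    refine (congrArg abs ?_).trans_le (key ((norm_snd_le _).trans (hchord b))
      ((norm_snd_le _).trans (hchord a)) (hosc a) (hosc b))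
    rw [hΔ]
    ring
  have hub : |u| ≤ 4 * L * (M * c) / |Δ| := by
    rw [le_div_iff₀ hΔpos, ← abs_mul]
    refine (congrArg abs ?_).trans_le (key ((norm_fst_le _).trans (hchord b))
      ((norm_fst_le _).trans (hchord a)) (hosc a) (hosc b))
    rw [hΔ]
    ring
  have hcs := Real.sin_sq_add_cos_sq θ
  have hrot : ∀ {k l : ℝ}, |k| ≤ 1 → |l| ≤ 1 → |k * u + l * v| ≤ |u| + |v| := by
    intro k l hk hl
    have h1 := mul_le_mul_of_nonneg_right hk (abs_nonneg u)
    have h2 := mul_le_mul_of_nonneg_right hl (abs_nonneg v)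
    rw [← abs_mul] at h1 h2
    linarith [abs_add_le (k * u) (l * v)]
  rw [Prod.norm_def]
  refine max_le ?_ ?_
  · have : P.1 = Real.cos θ * u + -Real.sin θ * v := by
      rw [hu, hv]
      linear_combination (-P.1) * hcs
    rw [this, Real.norm_eq_abs]
    linarith [hrot (Real.abs_cos_le_one θ) (abs_neg (Real.sin θ) ▸ Real.abs_sin_le_one θ)]
  · have : P.2 = Real.sin θ * u + Real.cos θ * v := by
      rw [hu, hv]
      linear_combination (-P.2) * hcs
    rw [this, Real.norm_eq_abs]
    linarith [hrot (Real.abs_sin_le_one θ) (Real.abs_cos_le_one θ)]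

theorem tangentSide_pos_or_neg {r : ℝ → ℝ × ℝ} (hr : Continuous r) (hr' : Continuous (deriv r))
    {θ : ℝ} {P : ℝ × ℝ} (h : ∀ s, tangentSide r θ P s ≠ 0) :
    (∀ s, 0 < tangentSide r θ P s) ∨ ∀ s, tangentSide r θ P s < 0 := by
  by_contra! hcon
  obtain ⟨⟨s, hs⟩, t, ht⟩ := hcon
  obtain ⟨z, hz⟩ := mem_range_of_exists_le_of_exists_ge (continuous_tangentSide hr hr' θ P)
    ⟨s, hs⟩ ⟨t, ht⟩
  exact h z hz

/-- The rotated no-silhouettes for angles of positive cosine all lie on the same side of the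
rotated tangent lines. -/
theorem exists_sign_mem_NS_iff {r : ℝ → ℝ × ℝ} {c : ℝ} (hc : 0 < c)
    (hd : Differentiable ℝ r) (hr' : Continuous (deriv r)) (hper : Function.Periodic r c)
    (himm : ∀ s, deriv r s ≠ 0) :
    ∃ σ : ℝ, |σ| = 1 ∧ ∀ θ, 0 < Real.cos θ → ∀ P,
      P ∈ NS θ r ↔ ∀ s, 0 < σ * tangentSide r θ P s := by
  by_cases hex : ∃ θ, 0 < Real.cos θ ∧ ∃ P, ∀ s, 0 < tangentSide r θ P s
  · obtain ⟨φ, hφ, Q, hQ⟩ := hex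
    refine ⟨1, abs_one, fun θ hθ P => ?_⟩
    rw [mem_NS_iff_tangentSide_ne_zero himm]
    simp only [one_mul]
    refine ⟨fun h => ?_, fun h s => (h s).ne'⟩
    exact (tangentSide_pos_or_neg hd.continuous hr' h).resolve_right fun hneg =>
      not_tangentSide_pos_and_neg hc hd hper hφ hθ hQ hneg
  · refine ⟨-1, by simp, fun θ hθ P => ?_⟩
    rw [mem_NS_iff_tangentSide_ne_zero himm]
    simp only [neg_mul, one_mul, neg_pos]
    refine ⟨fun h => ?_, fun h s => (h s).ne⟩
    exact (tangentSide_pos_or_neg hd.continuous hr' h).resolve_left fun hpos =>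
      hex ⟨θ, hθ, P, hpos⟩

theorem abs_tangentSide_sub_le {r : ℝ → ℝ × ℝ} {L L' D : ℝ} (hL : ∀ s, ‖r s‖ ≤ L)
    (hL' : ∀ s, ‖deriv r s‖ ≤ L') (θ φ : ℝ) {P : ℝ × ℝ} (hP : ‖P‖ ≤ D) (s : ℝ) :
    |tangentSide r θ P s - tangentSide r φ P s| ≤
      (|Real.cos θ - Real.cos φ| + |Real.sin θ - Real.sin φ|) * (2 * L' * (D + L)) := by
  have hPr : ‖P - r s‖ ≤ D + L := (norm_sub_le _ _).trans (add_le_add hP (hL s))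
  obtain ⟨h1, h2⟩ := abs_det_le_and_abs_dot_le (hL' s) hPr
  simp only [Prod.fst_sub, Prod.snd_sub] at h1 h2
  unfold tangentSide
  set A := (deriv r s).1 * (P.2 - (r s).2) - (deriv r s).2 * (P.1 - (r s).1)
  set B := (deriv r s).1 * (P.1 - (r s).1) + (deriv r s).2 * (P.2 - (r s).2)
  have hA := mul_le_mul_of_nonneg_left h1 (abs_nonneg (Real.cos θ - Real.cos φ))
  have hB := mul_le_mul_of_nonneg_left h2 (abs_nonneg (Real.sin θ - Real.sin φ))
  rw [← abs_mul] at hA hB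
  rw [show Real.cos θ * A - Real.sin θ * B - (Real.cos φ * A - Real.sin φ * B) =
    (Real.cos θ - Real.cos φ) * A - (Real.sin θ - Real.sin φ) * B by ring]
  linarith [abs_sub ((Real.cos θ - Real.cos φ) * A) ((Real.sin θ - Real.sin φ) * B)]

/-- Moving a point `P` towards `Q` by the proportion `E / δ` makes its side function positive, if
that function is greater than `-E` at `P` and at least `δ` at `Q`. -/
theorem exists_dist_le_tangentSide_pos {r : ℝ → ℝ × ℝ} {σ θ E δ D : ℝ} {P Q : ℝ × ℝ}
    (hE : 0 ≤ E) (hEδ : E < δ) (hP : ‖P‖ ≤ D) (hQ : ‖Q‖ ≤ D)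
    (hPs : ∀ s, -E < σ * tangentSide r θ P s) (hQs : ∀ s, δ ≤ σ * tangentSide r θ Q s) :
    ∃ P', (∀ s, 0 < σ * tangentSide r θ P' s) ∧ dist P P' ≤ E / δ * (2 * D) := by
  have hδ : 0 < δ := hE.trans_lt hEδ
  have ht0 : 0 ≤ E / δ := by positivity
  have ht1 : E / δ < 1 := (div_lt_one hδ).2 hEδ
  have htδ : E / δ * δ = E := div_mul_cancel₀ E hδ.ne'
  set t := E / δ
  refine ⟨P + t • (Q - P), fun s => ?_, ?_⟩
  · rw [tangentSide_convexComb]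
    have h1 := mul_lt_mul_of_pos_left (hPs s) (sub_pos.2 ht1)
    have h2 := mul_le_mul_of_nonneg_left (hQs s) ht0
    have h3 := mul_nonneg ht0 hE
    linarith
  · rw [dist_self_add_right, norm_smul, Real.norm_of_nonneg ht0]
    exact mul_le_mul_of_nonneg_left (by linarith [norm_sub_le Q P]) ht0

/-- Let `r` be a `C^∞` immersion of `S¹` in the plane with nonempty
no-silhouette and aperture angle `θr`.  Then the map
`ω : [0, θr) → 𝓗(ℝ²)`, `ω(θ) = closure 𝒩𝒮_{θ,r}`, is continuous with respect
to the Pompeiu–Hausdorff metric: at every point `θ₀` of `[0, θr)`, the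
Hausdorff distance `d_H(ω(θ), ω(θ₀))` tends to `0` as `θ → θ₀` in `[0, θr)`. -/
theorem closure_NS_continuous (r : ℝ → ℝ × ℝ)
    (hsmooth : ContDiff ℝ (⊤ : ℕ∞) r) (hper : Function.Periodic r (2 * π))
    (himm : ∀ s : ℝ, deriv r s ≠ 0)
    (hNS : (NS 0 r).Nonempty)
    (θr : ℝ) (hθr0 : 0 < θr) (hθr1 : θr ≤ π / 2)
    (haperture : ∀ θ : ℝ, 0 ≤ θ → θ < θr → (NS θ r).Nonempty)
    (hlargest : ∀ a : ℝ, (∀ θ : ℝ, 0 ≤ θ → θ < a → (NS θ r).Nonempty) → a ≤ θr) :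
    ∀ θ₀ ∈ Set.Ico 0 θr,
      Tendsto (fun θ : ℝ => Metric.hausdorffDist (closure (NS θ r)) (closure (NS θ₀ r)))
        (nhdsWithin θ₀ (Set.Ico 0 θr)) (nhds 0) := by
  intro θ₀ hθ₀
  have hc : 0 < 2 * π := Real.two_pi_pos
  have hd : Differentiable ℝ r := hsmooth.differentiable (by simp)
  have hr' : Continuous (deriv r) := hsmooth.continuous_deriv (by norm_cast)
  obtain ⟨σ, hσ, hmem⟩ := exists_sign_mem_NS_iff hc hd hr' hper himm
  obtain ⟨D, hD⟩ := exists_norm_le_of_tangentSide_pos hc hd hr' hper himm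
  obtain ⟨L, hL0, hL⟩ := hper.exists_norm_le hc hd.continuous
  obtain ⟨L', hL'0, hL'⟩ := hper.deriv_of_periodic.exists_norm_le hc hr'
  have hcos : ∀ θ ∈ Set.Ico 0 θr, 0 < Real.cos θ := fun θ hθ =>
    Real.cos_pos_of_mem_Ioo ⟨by linarith [hθ.1, Real.pi_pos], by linarith [hθ.2]⟩
  obtain ⟨Q, hQ⟩ := haperture θ₀ hθ₀.1 hθ₀.2
  rw [hmem θ₀ (hcos θ₀ hθ₀)] at hQ
  have hQD := hD σ θ₀ Q hσ hQ
  have hD0 : 0 ≤ D := (norm_nonneg _).trans hQD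
  obtain ⟨δ, hδ, hδQ⟩ := Function.Periodic.exists_pos_le hc
    (f := fun s => σ * tangentSide r θ₀ Q s) (fun s => by simp only [hper.tangentSide θ₀ Q s])
    (continuous_const.mul (continuous_tangentSide hd.continuous hr' θ₀ Q)) hQ
  set E : ℝ → ℝ := fun θ =>
    (|Real.cos θ - Real.cos θ₀| + |Real.sin θ - Real.sin θ₀|) * (2 * L' * (D + L)) with hE
  have hE0 : ∀ θ, 0 ≤ E θ := fun θ => by positivity
  have hElim : Tendsto E (nhds θ₀) (nhds 0) := by
    have : Continuous E := by fun_prop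
    convert this.tendsto θ₀ using 2
    simp [hE]
  have hdiff : ∀ θ P, ‖P‖ ≤ D → ∀ s,
      |σ * tangentSide r θ P s - σ * tangentSide r θ₀ P s| ≤ E θ := fun θ P hP s => by
    rw [← mul_sub, abs_mul, hσ, one_mul]
    exact abs_tangentSide_sub_le hL hL' θ θ₀ hP s
  have hsmall : ∀ᶠ θ in nhdsWithin θ₀ (Set.Ico 0 θr), E θ < δ / 2 :=
    (hElim.mono_left nhdsWithin_le_nhds).eventually_lt_const (half_pos hδ)
  have hlim : Tendsto (fun θ => E θ / (δ / 2) * (2 * D)) (nhdsWithin θ₀ (Set.Ico 0 θr))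
      (nhds 0) := by
    simpa using ((hElim.mono_left nhdsWithin_le_nhds).div_const (δ / 2)).mul_const (2 * D)
  refine tendsto_of_tendsto_of_tendsto_of_le_of_le' tendsto_const_nhds hlim
    (Eventually.of_forall fun θ => Metric.hausdorffDist_nonneg) ?_
  filter_upwards [hsmall, self_mem_nhdsWithin] with θ hθE hθ
  have hnonneg : 0 ≤ E θ / (δ / 2) * (2 * D) :=
    mul_nonneg (div_nonneg (hE0 θ) (half_pos hδ).le) (by positivity)
  rw [Metric.hausdorffDist_closure]
  refine Metric.hausdorffDist_le_of_mem_dist hnonneg ?_ ?_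
  · intro P hP
    rw [hmem θ (hcos θ hθ)] at hP
    have hPD := hD σ θ P hσ hP
    obtain ⟨P', hP', hdist⟩ := exists_dist_le_tangentSide_pos (r := r) (σ := σ) (θ := θ₀)
      (hE0 θ) hθE hPD hQD
      (fun s => by linarith [(abs_le.1 (hdiff θ P hPD s)).2, hP s])
      (fun s => by linarith [hδQ s])
    exact ⟨P', (hmem θ₀ (hcos θ₀ hθ₀) P').2 hP', hdist⟩
  · intro P hP
    rw [hmem θ₀ (hcos θ₀ hθ₀)] at hP
    have hPD := hD σ θ₀ P hσ hP
    obtain ⟨P', hP', hdist⟩ := exists_dist_le_tangentSide_pos (r := r) (σ := σ) (θ := θ)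
      (hE0 θ) hθE hPD hQD
      (fun s => by linarith [(abs_le.1 (hdiff θ P hPD s)).1, hP s])
      (fun s => by linarith [hδQ s, (abs_le.1 (hdiff θ Q hQD s)).1])
    exact ⟨P', (hmem θ (hcos θ hθ) P').2 hP', hdist⟩
end
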